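/- arXiv:2506.12998 — 10 statements merged into one kernel-verified Lean document; each statement's English description precedes it below -/
import Mathlib

section
/- Let H = (V, E, w) be a hypergraph with maximum hyperedge size k and a single monotone reward function r : {0,1,…,k} → ℝ with 0 = r(0) ≤ r(1) ≤ ⋯ ≤ r(k) applied to every edge (i.e. r_e(i) = r(i) for each e and i ≤ |e|), and suppose V is nonempty. If r(1) ≥ r(i)/i for every i ∈ {1,2,…,k}, then there is an optimal solution consisting of a single node: there exists v ∈ V such that Γ({v}) ≥ Γ(S) for every nonempty S ⊆ V. -/
open Finset

/-- Under the condition `r(i)/i ≤ r(1)`, the reward of `A ∩ S` is at most the total of the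
rewards of the traces of `A` on the single nodes of `S`. -/
theorem reward_card_inter_le_sum {α : Type*} [DecidableEq α] (A S : Finset α) (k : ℕ)
    (r : ℕ → ℝ) (hA : A.card ≤ k) (hr0 : r 0 = 0)
    (hcond : ∀ i, 1 ≤ i → i ≤ k → r i / (i : ℝ) ≤ r 1) :
    r (A ∩ S).card ≤ ∑ v ∈ S, r (A ∩ ({v} : Finset α)).card := by
  have hsum : ∑ v ∈ S, r (A ∩ ({v} : Finset α)).card = ((A ∩ S).card : ℝ) * r 1 := by
    have hterm : ∀ v ∈ S, r (A ∩ ({v} : Finset α)).card = if v ∈ A then r 1 else 0 := by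
      intro v _
      by_cases hv : v ∈ A
      · simp [hv, Finset.inter_singleton_of_mem]
      · simp [hv, Finset.inter_singleton_of_notMem, hr0]
    rw [Finset.sum_congr rfl hterm, ← Finset.sum_filter, Finset.sum_const, nsmul_eq_mul,
      Finset.filter_mem_eq_inter, Finset.inter_comm]
  rw [hsum]
  rcases Nat.eq_zero_or_pos (A ∩ S).card with h | h
  · simp [h, hr0]
  · have hle := hcond _ h ((Finset.card_le_card Finset.inter_subset_left).trans hA)
    rwa [div_le_iff₀ (by exact_mod_cast h), mul_comm] at hle

/-- If `r(1) ≥ r(i)/i` for every `i ∈ {1,…,k}`, then the densest SWAMP problem with the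
single monotone reward `r` applied to every edge has an optimal solution that is a
single node. -/
theorem swamp_single_node_optimal
    {α ι : Type*} [DecidableEq α]
    (V : Finset α) (E : Finset ι) (edge : ι → Finset α) (w : ι → ℝ)
    (k : ℕ) (r : ℕ → ℝ)
    (hedge : ∀ e ∈ E, edge e ⊆ V)
    (hsize : ∀ e ∈ E, (edge e).card ≤ k)
    (hw : ∀ e ∈ E, 0 ≤ w e)
    (hr0 : r 0 = 0)
    (hrmono : ∀ i, i < k → r i ≤ r (i + 1))
    (hV : V.Nonempty)
    (hcond : ∀ i, 1 ≤ i → i ≤ k → r i / (i : ℝ) ≤ r 1) :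
    ∃ v ∈ V, ∀ S : Finset α, S ⊆ V → S.Nonempty →
      (∑ e ∈ E, w e * r ((edge e ∩ S).card)) / (S.card : ℝ) ≤
      (∑ e ∈ E, w e * r ((edge e ∩ ({v} : Finset α)).card)) /
        ((({v} : Finset α).card : ℝ)) := by
  obtain ⟨v, hvV, hmax⟩ := Finset.exists_max_image V
    (fun v => ∑ e ∈ E, w e * r ((edge e ∩ ({v} : Finset α)).card)) hV
  refine ⟨v, hvV, fun S hSV hS => ?_⟩
  rw [Finset.card_singleton, Nat.cast_one, div_one,
    div_le_iff₀ (by exact_mod_cast hS.card_pos), mul_comm, ← nsmul_eq_mul]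
  calc ∑ e ∈ E, w e * r ((edge e ∩ S).card)
      ≤ ∑ e ∈ E, w e * ∑ u ∈ S, r ((edge e ∩ ({u} : Finset α)).card) :=
        Finset.sum_le_sum fun e he => mul_le_mul_of_nonneg_left
          (reward_card_inter_le_sum _ _ k r (hsize e he) hr0 hcond) (hw e he)
    _ = ∑ u ∈ S, ∑ e ∈ E, w e * r ((edge e ∩ ({u} : Finset α)).card) := by
        simp_rw [Finset.mul_sum]
        exact Finset.sum_comm
    _ ≤ S.card • ∑ e ∈ E, w e * r ((edge e ∩ ({v} : Finset α)).card) :=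
        Finset.sum_le_card_nsmul _ _ _ fun u hu => hmax u (hSV hu)
end

section
/- Let H = (V, E, {r_e}) be a hypergraph with unit edge weights, and let O ⊆ V be a nonempty optimal set, i.e. Γ(O) ≥ Γ(S) for every nonempty S ⊆ V. Then for every o ∈ O, Γ(O) ≤ Σ_{e ∈ E : o ∈ e} ( r_e(|e ∩ O|) − r_e(|e ∩ O| − 1) ). -/
open Finset

/-- For a hypergraph with unit edge weights and a nonempty optimal set `O`, for every
`o ∈ O` the density `Γ(O)` is at most the sum over edges containing `o` of
`r_e(|e ∩ O|) − r_e(|e ∩ O| − 1)`. -/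
theorem swamp_density_le_marginal
    {α ι : Type*} [DecidableEq α]
    (V : Finset α) (E : Finset ι) (edge : ι → Finset α) (r : ι → ℕ → ℝ)
    (hedge : ∀ e ∈ E, edge e ⊆ V)
    (hr0 : ∀ e ∈ E, r e 0 = 0)
    (hrmono : ∀ e ∈ E, ∀ i, i < (edge e).card → r e i ≤ r e (i + 1))
    (O : Finset α) (hOV : O ⊆ V) (hOne : O.Nonempty)
    (hopt : ∀ S : Finset α, S ⊆ V → S.Nonempty →
      (∑ e ∈ E, r e ((edge e ∩ S).card)) / (S.card : ℝ) ≤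
      (∑ e ∈ E, r e ((edge e ∩ O).card)) / (O.card : ℝ)) :
    ∀ o ∈ O,
      (∑ e ∈ E, r e ((edge e ∩ O).card)) / (O.card : ℝ) ≤
      ∑ e ∈ E.filter (fun e => o ∈ edge e),
        (r e ((edge e ∩ O).card) - r e ((edge e ∩ O).card - 1)) := by
  intro o ho
  have marginal_eq : ∑ e ∈ E.filter (fun e => o ∈ edge e),
        (r e ((edge e ∩ O).card) - r e ((edge e ∩ O).card - 1)) =
      ∑ e ∈ E, r e ((edge e ∩ O).card) - ∑ e ∈ E, r e ((edge e ∩ O.erase o).card) := by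
    rw [Finset.sum_filter, ← Finset.sum_sub_distrib]
    refine Finset.sum_congr rfl fun e _ => ?_
    rw [Finset.inter_erase]
    split_ifs with h
    · rw [Finset.card_erase_of_mem (Finset.mem_inter.2 ⟨h, ho⟩)]
    · rw [Finset.erase_eq_of_notMem (fun h' => h (Finset.mem_inter.1 h').1), sub_self]
  rw [marginal_eq]
  have hpos : (0 : ℝ) < O.card := by exact_mod_cast hOne.card_pos
  have hcard : ((O.erase o).card : ℝ) + 1 = O.card := by
    exact_mod_cast Finset.card_erase_add_one ho
  have hO : (∑ e ∈ E, r e ((edge e ∩ O).card)) / (O.card : ℝ) * O.card =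
      ∑ e ∈ E, r e ((edge e ∩ O).card) := div_mul_cancel₀ _ hpos.ne'
  have herase : ∑ e ∈ E, r e ((edge e ∩ O.erase o).card) ≤
      (∑ e ∈ E, r e ((edge e ∩ O).card)) / (O.card : ℝ) * (O.erase o).card := by
    rcases (O.erase o).eq_empty_or_nonempty with h | h
    · simp [h, Finset.sum_eq_zero hr0]
    · have hpos' : (0 : ℝ) < (O.erase o).card := by exact_mod_cast h.card_pos
      exact (div_le_iff₀ hpos').1 (hopt _ ((Finset.erase_subset o O).trans hOV) h)
  rw [← hcard] at hO herase ⊢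
  linarith
end

section
/- Let H = (V, E, {r_e}) be a hypergraph with unit edge weights and maximum hyperedge size k. For each edge e let s_e : {0,1,…,|e|−1} → ℝ satisfy 0 ≤ s_e(i) ≤ r_e(i) for all i, and r_e(i) − s_e(i−1) ≤ r_e(i+1) − s_e(i) for all i ∈ {1,…,|e|−1}. Let O ⊆ V be a nonempty optimal set, let X ⊆ V satisfy O ⊆ X, and let x ∈ O be a node that minimizes, over all u ∈ X, the quantity Σ_{e : u ∈ e} ( r_e(|e ∩ X|) − s_e(|e ∩ X| − 1) ). Then Γ(O) ≤ k·Γ(X). Consequently, the peeling algorithm that, starting from X = V, repeatedly removes such a minimizing node and returns the intermediate set of largest density is a 1/k-approximation for the densest SWAMP problem. -/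
open Finset

/-- A function that increases at each step of `[a, n]` is monotone there. -/
lemma le_of_step_le_of_mem_range {g : ℕ → ℝ} {a n : ℕ}
    (hg : ∀ i, a ≤ i → i < n → g i ≤ g (i + 1)) {i j : ℕ}
    (hai : a ≤ i) (hij : i ≤ j) (hjn : j ≤ n) : g i ≤ g j := by
  induction j, hij using Nat.le_induction with
  | base => exact le_rfl
  | succ m him ih => exact (ih (by omega)).trans (hg m (by omega) (by omega))

/-- The reward of a hyperedge is nonnegative. -/
lemma reward_nonneg_of_step_le {g : ℕ → ℝ} {n : ℕ} (h0 : g 0 = 0)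
    (hg : ∀ i, i < n → g i ≤ g (i + 1)) {i : ℕ} (hi : i ≤ n) : 0 ≤ g i := by
  rw [← h0]
  exact le_of_step_le_of_mem_range (fun i _ h => hg i h) le_rfl (Nat.zero_le i) hi

/-- Double counting of node-hyperedge incidences inside `X`. -/
lemma sum_sum_filter_mem_eq_sum_card_mul {α ι : Type*} [DecidableEq α]
    (E : Finset ι) (edge : ι → Finset α) (X : Finset α) (g : ι → ℝ) :
    ∑ u ∈ X, ∑ e ∈ E.filter (fun e => u ∈ edge e), g e
      = ∑ e ∈ E, ((edge e ∩ X).card : ℝ) * g e := by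
  simp_rw [Finset.sum_filter]
  rw [Finset.sum_comm]
  refine Finset.sum_congr rfl fun e _ => ?_
  rw [← Finset.sum_filter, Finset.sum_const, nsmul_eq_mul, Finset.filter_mem_eq_inter,
    Finset.inter_comm]

/-- Removing a node from a densest set `O` loses at least the density of `O`. -/
lemma density_le_sub_erase_of_optimal {α : Type*} [DecidableEq α]
    {V O : Finset α} {f : Finset α → ℝ} (hf : f ∅ = 0) (hOV : O ⊆ V)
    (hopt : ∀ S : Finset α, S ⊆ V → S.Nonempty → f S / (S.card : ℝ) ≤ f O / (O.card : ℝ))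
    {x : α} (hx : x ∈ O) : f O / (O.card : ℝ) ≤ f O - f (O.erase x) := by
  have hOpos : (0 : ℝ) < O.card := by exact_mod_cast Finset.card_pos.2 ⟨x, hx⟩
  have hcard : ((O.erase x).card : ℝ) + 1 = O.card := by
    exact_mod_cast Finset.card_erase_add_one hx
  have hmul : f O / (O.card : ℝ) * O.card = f O := div_mul_cancel₀ _ hOpos.ne'
  have hle : f (O.erase x) ≤ f O / (O.card : ℝ) * (O.erase x).card := by
    rcases (O.erase x).eq_empty_or_nonempty with h | h
    · simp [h, hf]
    · have hpos : (0 : ℝ) < (O.erase x).card := by exact_mod_cast Finset.card_pos.2 h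
      exact (div_le_iff₀ hpos).1 (hopt _ ((Finset.erase_subset x O).trans hOV) h)
  rw [← hcard] at hmul hle ⊢
  linarith

/-- If the node minimizing the surrogate marginal over `X` lies in a densest set `O ⊆ X`,
then `X` is a `1/k`-approximation. -/
lemma density_le_mul_density_of_minimizer_mem {α ι : Type*} [DecidableEq α]
    (V : Finset α) (E : Finset ι) (edge : ι → Finset α)
    (r s : ι → ℕ → ℝ) (k : ℕ)
    (hsize : ∀ e ∈ E, (edge e).card ≤ k)
    (hr0 : ∀ e ∈ E, r e 0 = 0)
    (hrmono : ∀ e ∈ E, ∀ i, i < (edge e).card → r e i ≤ r e (i + 1))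
    (hs0 : ∀ e ∈ E, ∀ i, i < (edge e).card → 0 ≤ s e i ∧ s e i ≤ r e i)
    (hs1 : ∀ e ∈ E, ∀ i, 1 ≤ i → i < (edge e).card →
      r e i - s e (i - 1) ≤ r e (i + 1) - s e i)
    (O X : Finset α) (x : α) (hOX : O ⊆ X) (hXV : X ⊆ V)
    (hopt : ∀ S : Finset α, S ⊆ V → S.Nonempty →
        (∑ e ∈ E, r e ((edge e ∩ S).card)) / (S.card : ℝ) ≤
        (∑ e ∈ E, r e ((edge e ∩ O).card)) / (O.card : ℝ))
    (hx : x ∈ O)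
    (hmin : ∀ u ∈ X,
        ∑ e ∈ E.filter (fun e => x ∈ edge e),
            (r e ((edge e ∩ X).card) - s e ((edge e ∩ X).card - 1)) ≤
        ∑ e ∈ E.filter (fun e => u ∈ edge e),
            (r e ((edge e ∩ X).card) - s e ((edge e ∩ X).card - 1))) :
    (∑ e ∈ E, r e ((edge e ∩ O).card)) / (O.card : ℝ) ≤
      (k : ℝ) * ((∑ e ∈ E, r e ((edge e ∩ X).card)) / (X.card : ℝ)) := by
  have hle : ∀ (e : ι) (S : Finset α), (edge e ∩ S).card ≤ (edge e).card := fun e S =>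
    Finset.card_le_card Finset.inter_subset_left
  have hXpos : (0 : ℝ) < X.card := by exact_mod_cast Finset.card_pos.2 ⟨x, hOX hx⟩
  have hdrop := density_le_sub_erase_of_optimal
    (f := fun S => ∑ e ∈ E, r e ((edge e ∩ S).card))
    (by simpa using Finset.sum_eq_zero hr0) (hOX.trans hXV) hopt hx
  have hmarg : (∑ e ∈ E, r e ((edge e ∩ O).card)) - ∑ e ∈ E, r e ((edge e ∩ O.erase x).card)
      ≤ ∑ e ∈ E.filter (fun e => x ∈ edge e),
          (r e ((edge e ∩ X).card) - s e ((edge e ∩ X).card - 1)) := by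
    rw [← Finset.sum_sub_distrib, Finset.sum_filter]
    refine Finset.sum_le_sum fun e he => ?_
    rw [Finset.inter_erase]
    split_ifs with hxe
    · have hmem : x ∈ edge e ∩ O := Finset.mem_inter.2 ⟨hxe, hx⟩
      have hpos : 0 < (edge e ∩ O).card := Finset.card_pos.2 ⟨x, hmem⟩
      have hs := (hs0 e he ((edge e ∩ O).card - 1) (by have := hle e O; omega)).2
      have hg := le_of_step_le_of_mem_range (g := fun i => r e i - s e (i - 1)) (hs1 e he)
        hpos (Finset.card_le_card (Finset.inter_subset_inter_left hOX)) (hle e X)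
      rw [Finset.card_erase_of_mem hmem]
      linarith
    · rw [Finset.erase_eq_of_notMem fun h => hxe (Finset.mem_inter.1 h).1, sub_self]
  have hsum := Finset.card_nsmul_le_sum X _ _ hmin
  rw [sum_sum_filter_mem_eq_sum_card_mul, nsmul_eq_mul] at hsum
  have hbound : ∑ e ∈ E, ((edge e ∩ X).card : ℝ) *
        (r e ((edge e ∩ X).card) - s e ((edge e ∩ X).card - 1))
      ≤ k * ∑ e ∈ E, r e ((edge e ∩ X).card) := by
    rw [Finset.mul_sum]
    refine Finset.sum_le_sum fun e he => ?_
    have hr : 0 ≤ r e ((edge e ∩ X).card) :=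
      reward_nonneg_of_step_le (hr0 e he) (hrmono e he) (hle e X)
    have hk : ((edge e ∩ X).card : ℝ) ≤ k := by exact_mod_cast (hle e X).trans (hsize e he)
    refine le_trans ?_ (mul_le_mul_of_nonneg_right hk hr)
    rcases Nat.eq_zero_or_pos (edge e ∩ X).card with h | h
    · simp [h]
    · have hs := (hs0 e he ((edge e ∩ X).card - 1) (by have := hle e X; omega)).1
      exact mul_le_mul_of_nonneg_left (by linarith) (Nat.cast_nonneg _)
  refine (hdrop.trans hmarg).trans ?_
  rw [← mul_div_assoc, le_div_iff₀ hXpos, mul_comm]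
  exact hsum.trans hbound

/-- A sequence of sets that starts at `V ⊇ O` and loses one node at a time removes a node of `O`
while all of `O` is still present. -/
lemma exists_first_removed_mem {α : Type*} [DecidableEq α] {O : Finset α} {X : ℕ → Finset α}
    {v : ℕ → α} (hO : O.Nonempty) (hOX : O ⊆ X 0)
    (hstep : ∀ j, (X j).Nonempty → v j ∈ X j ∧ X (j + 1) = X j \ {v j}) :
    ∃ j, O ⊆ X j ∧ X j ⊆ X 0 ∧ v j ∈ O := by
  by_contra! hnot
  have hsub : ∀ j, O ⊆ X j ∧ X j ⊆ X 0 ∧ (X j).card + j = (X 0).card := by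
    intro j
    induction j with
    | zero => exact ⟨hOX, Subset.rfl, rfl⟩
    | succ j ih =>
      obtain ⟨hmem, heq⟩ := hstep j (hO.mono ih.1)
      rw [heq, Finset.sdiff_singleton_eq_erase]
      refine ⟨fun y hy => Finset.mem_erase.2 ⟨?_, ih.1 hy⟩, (Finset.erase_subset _ _).trans ih.2.1, ?_⟩
      · rintro rfl
        exact hnot j ih.1 ih.2.1 hy
      · have := Finset.card_erase_add_one hmem
        have := ih.2.2
        omega
  obtain ⟨h, -, hcard⟩ := hsub (X 0).card
  have := Finset.card_pos.2 (hO.mono h)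
  omega

/-- Peeling with a bound function `s_e` satisfying `0 ≤ s_e(i) ≤ r_e(i)` and
`r_e(i) − s_e(i−1) ≤ r_e(i+1) − s_e(i)`.  First conjunct: if `O` is a nonempty optimal
set, `O ⊆ X`, and `x ∈ O` minimizes `∑_{e ∋ u} (r_e(|e∩X|) − s_e(|e∩X|−1))` over `u ∈ X`,
then `Γ(O) ≤ k · Γ(X)`.  Second conjunct: consequently, the peeling algorithm that starts
from `V`, repeatedly removes such a minimizing node, and returns the best intermediate
set, is a `1/k`-approximation for the densest SWAMP problem. -/
theorem swamp_peeling_approximation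
    {α ι : Type*} [DecidableEq α]
    (V : Finset α) (E : Finset ι) (edge : ι → Finset α)
    (r s : ι → ℕ → ℝ) (k : ℕ)
    (hedge : ∀ e ∈ E, edge e ⊆ V)
    (hsize : ∀ e ∈ E, (edge e).card ≤ k)
    (hr0 : ∀ e ∈ E, r e 0 = 0)
    (hrmono : ∀ e ∈ E, ∀ i, i < (edge e).card → r e i ≤ r e (i + 1))
    (hs0 : ∀ e ∈ E, ∀ i, i < (edge e).card → 0 ≤ s e i ∧ s e i ≤ r e i)
    (hs1 : ∀ e ∈ E, ∀ i, 1 ≤ i → i < (edge e).card →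
      r e i - s e (i - 1) ≤ r e (i + 1) - s e i) :
    (∀ (O X : Finset α) (x : α),
      O.Nonempty → O ⊆ X → X ⊆ V →
      (∀ S : Finset α, S ⊆ V → S.Nonempty →
        (∑ e ∈ E, r e ((edge e ∩ S).card)) / (S.card : ℝ) ≤
        (∑ e ∈ E, r e ((edge e ∩ O).card)) / (O.card : ℝ)) →
      x ∈ O →
      (∀ u ∈ X,
        ∑ e ∈ E.filter (fun e => x ∈ edge e),
            (r e ((edge e ∩ X).card) - s e ((edge e ∩ X).card - 1)) ≤
        ∑ e ∈ E.filter (fun e => u ∈ edge e),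
            (r e ((edge e ∩ X).card) - s e ((edge e ∩ X).card - 1))) →
      (∑ e ∈ E, r e ((edge e ∩ O).card)) / (O.card : ℝ) ≤
        (k : ℝ) * ((∑ e ∈ E, r e ((edge e ∩ X).card)) / (X.card : ℝ)))
    ∧
    (∀ (X : ℕ → Finset α) (v : ℕ → α) (O : Finset α),
      X 0 = V →
      (∀ j, (X j).Nonempty →
        v j ∈ X j ∧
        (∀ u ∈ X j,
          ∑ e ∈ E.filter (fun e => v j ∈ edge e),
              (r e ((edge e ∩ X j).card) - s e ((edge e ∩ X j).card - 1)) ≤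
          ∑ e ∈ E.filter (fun e => u ∈ edge e),
              (r e ((edge e ∩ X j).card) - s e ((edge e ∩ X j).card - 1))) ∧
        X (j + 1) = X j \ {v j}) →
      O ⊆ V → O.Nonempty →
      (∀ S : Finset α, S ⊆ V → S.Nonempty →
        (∑ e ∈ E, r e ((edge e ∩ S).card)) / (S.card : ℝ) ≤
        (∑ e ∈ E, r e ((edge e ∩ O).card)) / (O.card : ℝ)) →
      ∃ j, (X j).Nonempty ∧
        (∑ e ∈ E, r e ((edge e ∩ O).card)) / (O.card : ℝ) ≤
        (k : ℝ) * ((∑ e ∈ E, r e ((edge e ∩ X j).card)) / ((X j).card : ℝ))) := by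
  have key := density_le_mul_density_of_minimizer_mem V E edge r s k hsize hr0 hrmono hs0 hs1
  refine ⟨fun O X x _ hOX hXV hopt hx hmin => key O X x hOX hXV hopt hx hmin,
    fun X v O hX0 hstep hOV hO hopt => ?_⟩
  obtain ⟨j, hOX, hXV, hv⟩ := exists_first_removed_mem (X := X) (v := v) hO (hX0 ▸ hOV)
    fun j hj => ⟨(hstep j hj).1, (hstep j hj).2.2⟩
  exact ⟨j, hO.mono hOX, key O (X j) (v j) hOX (hX0 ▸ hXV) hopt hv
    (hstep j (hO.mono hOX)).2.1⟩
end

section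
/- Let k ≥ 1 and let r : {0,1,…,k} → ℝ be monotone with 0 = r(0) ≤ r(1) ≤ ⋯ ≤ r(k). Then there exists a function r̂ : {0,1,…,k} → ℝ that is nonnegative, monotone, convex (i.e. r̂(i+1) − r̂(i) ≥ r̂(i) − r̂(i−1) for all i ∈ {1,…,k−1}), satisfies r̂(0) = 0, and satisfies r̂(i) ≤ r(i) ≤ k·r̂(i) for every i ∈ {1,2,…,k}. -/
open Finset

/-- The hinge function that vanishes up to `j - 1` and is affine from there with value `c` at `k`. -/
noncomputable def hinge (k : ℕ) (c : ℝ) (j i : ℕ) : ℝ :=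
  c / ((k : ℝ) + 1 - j) * max 0 ((i : ℝ) + 1 - j)

lemma hinge_slope_nonneg {k j : ℕ} {c : ℝ} (hc : 0 ≤ c) (hj : j ≤ k) :
    0 ≤ c / ((k : ℝ) + 1 - j) := by
  have : (j : ℝ) ≤ k := by exact_mod_cast hj
  exact div_nonneg hc (by linarith)

lemma hinge_zero {k j : ℕ} {c : ℝ} (hj : 1 ≤ j) : hinge k c j 0 = 0 := by
  have : (1 : ℝ) ≤ j := by exact_mod_cast hj
  rw [hinge, max_eq_left (by push_cast; linarith), mul_zero]

lemma hinge_nonneg {k j : ℕ} {c : ℝ} (hc : 0 ≤ c) (hj : j ≤ k) (i : ℕ) : 0 ≤ hinge k c j i :=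
  mul_nonneg (hinge_slope_nonneg hc hj) (le_max_left _ _)

lemma hinge_mono {k j : ℕ} {c : ℝ} (hc : 0 ≤ c) (hj : j ≤ k) : Monotone (hinge k c j) := by
  intro a b hab
  have : (a : ℝ) ≤ b := by exact_mod_cast hab
  exact mul_le_mul_of_nonneg_left (max_le_max le_rfl (by linarith)) (hinge_slope_nonneg hc hj)

lemma two_mul_hinge_le {k j : ℕ} {c : ℝ} (hc : 0 ≤ c) (hj : j ≤ k) (i : ℕ) :
    2 * hinge k c j (i + 1) ≤ hinge k c j i + hinge k c j (i + 2) := by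
  have hmax : 2 * max 0 (((i + 1 : ℕ) : ℝ) + 1 - j) ≤
      max 0 ((i : ℝ) + 1 - j) + max 0 (((i + 2 : ℕ) : ℝ) + 1 - j) := by
    push_cast
    have h₁ := le_max_left 0 ((i : ℝ) + 1 - j)
    have h₂ := le_max_right 0 ((i : ℝ) + 1 - j)
    have h₃ := le_max_left 0 ((i : ℝ) + 2 + 1 - j)
    have h₄ := le_max_right 0 ((i : ℝ) + 2 + 1 - j)
    rcases max_cases 0 ((i : ℝ) + 1 + 1 - j) with h | h <;> linarith [h.1]
  have := mul_le_mul_of_nonneg_left hmax (hinge_slope_nonneg hc hj)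
  unfold hinge
  linarith

lemma hinge_of_lt {k i j : ℕ} {c : ℝ} (hij : i < j) : hinge k c j i = 0 := by
  have : (i : ℝ) + 1 ≤ j := by exact_mod_cast hij
  rw [hinge, max_eq_left (by linarith), mul_zero]

lemma hinge_le {k i j : ℕ} {c : ℝ} (hc : 0 ≤ c) (hj : j ≤ k) (hi : i ≤ k) :
    hinge k c j i ≤ c := by
  have hjk : (j : ℝ) ≤ k := by exact_mod_cast hj
  have hik : (i : ℝ) ≤ k := by exact_mod_cast hi
  have hpos : (0 : ℝ) < k + 1 - j := by linarith
  calc hinge k c j i ≤ c / ((k : ℝ) + 1 - j) * ((k : ℝ) + 1 - j) :=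
        mul_le_mul_of_nonneg_left (max_le hpos.le (by linarith)) (hinge_slope_nonneg hc hj)
    _ = c := div_mul_cancel₀ c hpos.ne'

lemma le_mul_hinge_self {k j : ℕ} {c : ℝ} (hc : 0 ≤ c) (hj : 1 ≤ j) (hjk : j ≤ k) :
    c ≤ k * hinge k c j j := by
  have h1 : (1 : ℝ) ≤ j := by exact_mod_cast hj
  have h2 : (j : ℝ) ≤ k := by exact_mod_cast hjk
  have hpos : (0 : ℝ) < k + 1 - j := by linarith
  calc c = ((k : ℝ) + 1 - j) * (c / ((k : ℝ) + 1 - j)) := (mul_div_cancel₀ c hpos.ne').symm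
    _ ≤ k * (c / ((k : ℝ) + 1 - j)) :=
        mul_le_mul_of_nonneg_right (by linarith) (hinge_slope_nonneg hc hjk)
    _ = k * hinge k c j j := by
        rw [hinge, max_eq_right (by linarith)]
        ring

/-- For any monotone reward `r : {0,…,k} → ℝ` with `r(0) = 0` there exists a
nonnegative, monotone, convex function `r̂` with `r̂(0) = 0` satisfying
`r̂(i) ≤ r(i) ≤ k·r̂(i)` for every `i ∈ {1,…,k}`. -/
theorem exists_convex_projection
    (k : ℕ) (hk : 1 ≤ k) (r : ℕ → ℝ)
    (hr0 : r 0 = 0) (hrmono : ∀ i, i < k → r i ≤ r (i + 1)) :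
    ∃ rh : ℕ → ℝ,
      rh 0 = 0 ∧
      (∀ i, i ≤ k → 0 ≤ rh i) ∧
      (∀ i, i < k → rh i ≤ rh (i + 1)) ∧
      (∀ i, 1 ≤ i → i < k → rh i - rh (i - 1) ≤ rh (i + 1) - rh i) ∧
      (∀ i, 1 ≤ i → i ≤ k → rh i ≤ r i ∧ r i ≤ (k : ℝ) * rh i) := by
  have mono : ∀ i j, i ≤ j → j ≤ k → r i ≤ r j := by
    intro i j hij
    induction j, hij using Nat.le_induction with
    | base => exact fun _ => le_rfl
    | succ j _ ih => exact fun hj => (ih (by omega)).trans (hrmono j (by omega))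
  have nonneg : ∀ j, j ≤ k → 0 ≤ r j := fun j hj => hr0 ▸ mono 0 j (Nat.zero_le j) hj
  have hne : (Icc 1 k).Nonempty := ⟨1, mem_Icc.2 ⟨le_rfl, hk⟩⟩
  have le_sup : ∀ i j, 1 ≤ j → j ≤ k →
      hinge k (r j) j i ≤ (Icc 1 k).sup' hne fun j => hinge k (r j) j i := fun i j h₁ h₂ =>
    le_sup' (fun j => hinge k (r j) j i) (mem_Icc.2 ⟨h₁, h₂⟩)
  refine ⟨fun i => (Icc 1 k).sup' hne fun j => hinge k (r j) j i, ?_, ?_, ?_, ?_, ?_⟩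
  · refine le_antisymm (sup'_le _ _ fun j hj => (hinge_zero (mem_Icc.1 hj).1).le) ?_
    exact (hinge_nonneg (nonneg 1 hk) hk 0).trans (le_sup 0 1 le_rfl hk)
  · exact fun i _ => (hinge_nonneg (nonneg 1 hk) hk i).trans (le_sup i 1 le_rfl hk)
  · intro i _
    refine sup'_le _ _ fun j hj => ?_
    obtain ⟨h₁, h₂⟩ := mem_Icc.1 hj
    exact (hinge_mono (nonneg j h₂) h₂ i.le_succ).trans (le_sup (i + 1) j h₁ h₂)
  · intro i hi _
    obtain ⟨i, rfl⟩ := Nat.exists_eq_add_of_le' hi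
    obtain ⟨j, hj, hmax⟩ := exists_mem_eq_sup' hne fun j => hinge k (r j) j (i + 1)
    obtain ⟨h₁, h₂⟩ := mem_Icc.1 hj
    have hconv := two_mul_hinge_le (nonneg j h₂) h₂ i
    have hl := le_sup i j h₁ h₂
    have hr := le_sup (i + 2) j h₁ h₂
    simp only [Nat.add_sub_cancel, hmax]
    linarith
  · intro i hi hik
    refine ⟨sup'_le _ _ fun j hj => ?_, ?_⟩
    · obtain ⟨_, h₂⟩ := mem_Icc.1 hj
      rcases lt_or_ge i j with hij | hij
      · exact (hinge_of_lt hij).trans_le (nonneg i hik)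
      · exact (hinge_le (nonneg j h₂) h₂ hik).trans (mono j i hij hik)
    · exact (le_mul_hinge_self (nonneg i hik) hi hik).trans
        (mul_le_mul_of_nonneg_left (le_sup i i hi hik) k.cast_nonneg)
end

section
/- Let k ≥ 1 and let r : {0,1,…,k} → ℝ be defined by r(0) = 0 and r(i) = 1 for all i ∈ {1,…,k}. Then every monotone, convex function r̂ : {0,1,…,k} → ℝ with r̂(0) = 0 and r̂(i) ≤ r(i) for all i satisfies r̂(1) ≤ 1/k. In particular, for the step reward r the factor k in the bound r(i) ≤ k·r̂(i) cannot be improved: r(1)/r̂(1) ≥ k whenever r̂(1) > 0. -/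
open Finset

/-- The increments of a convex sequence are at least its first increment. -/
theorem first_increment_le_of_convex (k : ℕ) (f : ℕ → ℝ)
    (hconv : ∀ i, 1 ≤ i → i < k → f i - f (i - 1) ≤ f (i + 1) - f i) :
    ∀ i, i < k → f 1 - f 0 ≤ f (i + 1) - f i := by
  intro i
  induction i with
  | zero => intro _; simp
  | succ n ih =>
    intro hn
    have h := hconv (n + 1) (by omega) hn
    rw [Nat.add_sub_cancel] at h
    exact (ih (by omega)).trans h

/-- A convex sequence lies above the line through its first two points. -/
theorem mul_first_increment_le_of_convex (k : ℕ) (f : ℕ → ℝ)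
    (hconv : ∀ i, 1 ≤ i → i < k → f i - f (i - 1) ≤ f (i + 1) - f i) :
    ∀ i, i ≤ k → (i : ℝ) * (f 1 - f 0) ≤ f i - f 0 := by
  intro i
  induction i with
  | zero => intro _; simp
  | succ n ih =>
    intro hn
    have h := first_increment_le_of_convex k f hconv n (by omega)
    have h' := ih (by omega)
    push_cast
    linarith

/-- For the step reward `r(0) = 0`, `r(i) = 1` for `i ∈ {1,…,k}`, any monotone convex
minorant `r̂` with `r̂(0) = 0` satisfies `r̂(1) ≤ 1/k`; in particular the factor `k` in
the bound `r(i) ≤ k·r̂(i)` cannot be improved: `r(1)/r̂(1) ≥ k` whenever `r̂(1) > 0`. -/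
theorem step_reward_projection_tight
    (k : ℕ) (hk : 1 ≤ k) (r : ℕ → ℝ)
    (hr0 : r 0 = 0) (hrstep : ∀ i, 1 ≤ i → i ≤ k → r i = 1)
    (rh : ℕ → ℝ)
    (hrh0 : rh 0 = 0)
    (hrhmono : ∀ i, i < k → rh i ≤ rh (i + 1))
    (hrhconv : ∀ i, 1 ≤ i → i < k → rh i - rh (i - 1) ≤ rh (i + 1) - rh i)
    (hrhle : ∀ i, i ≤ k → rh i ≤ r i) :
    rh 1 ≤ 1 / (k : ℝ) ∧ (0 < rh 1 → (k : ℝ) ≤ r 1 / rh 1) := by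
  have hkpos : (0 : ℝ) < k := by exact_mod_cast hk
  have hline := mul_first_increment_le_of_convex k rh hrhconv k le_rfl
  have hlast := hrhle k le_rfl
  rw [hrstep k hk le_rfl] at hlast
  rw [hrh0, sub_zero, sub_zero] at hline
  have hmul : (k : ℝ) * rh 1 ≤ 1 := hline.trans hlast
  refine ⟨?_, fun hpos => ?_⟩
  · rw [le_div_iff₀ hkpos, mul_comm]
    exact hmul
  · rw [hrstep 1 le_rfl hk, le_div_iff₀ hpos]
    exact hmul
end

section
/- Let H = (V, E, w, {r_e}) be a hypergraph with maximum hyperedge size k, and for each edge e let r̂_e : {0,1,…,|e|} → ℝ be a monotone function with r̂_e(0) = 0 satisfying r̂_e(i) ≤ r_e(i) ≤ k·r̂_e(i) for every i ∈ {1,…,|e|}. Let Γ̂ be the density defined using the rewards r̂_e. If β ∈ (0,1] and a nonempty set S ⊆ V is a β-approximate solution for Γ̂, i.e. Γ̂(S) ≥ β·Γ̂(T) for every nonempty T ⊆ V, then S is a (β/k)-approximate solution for Γ, i.e. Γ(S) ≥ (β/k)·Γ(T) for every nonempty T ⊆ V. -/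
open Finset

/-- If the projected monotone rewards satisfy `r̂_e(i) ≤ r_e(i) ≤ k·r̂_e(i)` for every
edge `e` and every `i ∈ {1,…,|e|}` (where `k` bounds the hyperedge sizes), then any
`β`-approximate solution `S` for the projected density `Γ̂` is a `(β/k)`-approximate
solution for the original density `Γ`. -/
theorem swamp_projection_approximation
    {α ι : Type*} [DecidableEq α]
    (V : Finset α) (E : Finset ι) (edge : ι → Finset α) (w : ι → ℝ)
    (r rh : ι → ℕ → ℝ) (k : ℕ)
    (hedge : ∀ e ∈ E, edge e ⊆ V)
    (hsize : ∀ e ∈ E, (edge e).card ≤ k)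
    (hw : ∀ e ∈ E, 0 ≤ w e)
    (hr0 : ∀ e ∈ E, r e 0 = 0)
    (hrmono : ∀ e ∈ E, ∀ i, i < (edge e).card → r e i ≤ r e (i + 1))
    (hrh0 : ∀ e ∈ E, rh e 0 = 0)
    (hrhmono : ∀ e ∈ E, ∀ i, i < (edge e).card → rh e i ≤ rh e (i + 1))
    (hsandwich : ∀ e ∈ E, ∀ i, 1 ≤ i → i ≤ (edge e).card →
      rh e i ≤ r e i ∧ r e i ≤ (k : ℝ) * rh e i)
    (β : ℝ) (hβ0 : 0 < β) (hβ1 : β ≤ 1)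
    (S : Finset α) (hSV : S ⊆ V) (hSne : S.Nonempty)
    (happrox : ∀ T : Finset α, T ⊆ V → T.Nonempty →
      β * ((∑ e ∈ E, w e * rh e ((edge e ∩ T).card)) / (T.card : ℝ)) ≤
      (∑ e ∈ E, w e * rh e ((edge e ∩ S).card)) / (S.card : ℝ)) :
    ∀ T : Finset α, T ⊆ V → T.Nonempty →
      (β / (k : ℝ)) * ((∑ e ∈ E, w e * r e ((edge e ∩ T).card)) / (T.card : ℝ)) ≤
      (∑ e ∈ E, w e * r e ((edge e ∩ S).card)) / (S.card : ℝ) := by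
  have bounds : ∀ T : Finset α, ∀ e ∈ E,
      rh e ((edge e ∩ T).card) ≤ r e ((edge e ∩ T).card) ∧
      r e ((edge e ∩ T).card) ≤ (k : ℝ) * rh e ((edge e ∩ T).card) := by
    intro T e he
    rcases Nat.eq_zero_or_pos (edge e ∩ T).card with h | h
    · rw [h, hr0 e he, hrh0 e he]
      simp
    · exact hsandwich e he _ h (card_le_card inter_subset_left)
  intro T hTV hTne
  rcases Nat.eq_zero_or_pos k with hk | hk
  · have hzero : ∑ e ∈ E, w e * r e ((edge e ∩ S).card) = 0 := by
      refine sum_eq_zero fun e he => ?_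
      have hcard : (edge e ∩ S).card = 0 := by
        have h1 := hsize e he
        have h2 : (edge e ∩ S).card ≤ (edge e).card := card_le_card inter_subset_left
        omega
      rw [hcard, hr0 e he, mul_zero]
    rw [hzero, hk]
    simp
  · have hk' : (0 : ℝ) < k := by exact_mod_cast hk
    have upper : ∑ e ∈ E, w e * r e ((edge e ∩ T).card) ≤
        (k : ℝ) * ∑ e ∈ E, w e * rh e ((edge e ∩ T).card) := by
      rw [mul_sum]
      refine sum_le_sum fun e he => ?_
      rw [mul_left_comm]
      exact mul_le_mul_of_nonneg_left (bounds T e he).2 (hw e he)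
    have lower : ∑ e ∈ E, w e * rh e ((edge e ∩ S).card) ≤
        ∑ e ∈ E, w e * r e ((edge e ∩ S).card) :=
      sum_le_sum fun e he => mul_le_mul_of_nonneg_left (bounds S e he).1 (hw e he)
    calc (β / (k : ℝ)) * ((∑ e ∈ E, w e * r e ((edge e ∩ T).card)) / (T.card : ℝ))
        ≤ (β / (k : ℝ)) *
            (((k : ℝ) * ∑ e ∈ E, w e * rh e ((edge e ∩ T).card)) / (T.card : ℝ)) := by
          gcongr
      _ = β * ((∑ e ∈ E, w e * rh e ((edge e ∩ T).card)) / (T.card : ℝ)) := by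
          rw [mul_div_assoc, ← mul_assoc, div_mul_cancel₀ _ hk'.ne']
      _ ≤ (∑ e ∈ E, w e * rh e ((edge e ∩ S).card)) / (S.card : ℝ) := happrox T hTV hTne
      _ ≤ (∑ e ∈ E, w e * r e ((edge e ∩ S).card)) / (S.card : ℝ) := by
          gcongr
end

section
/- Let H = (V, E, w, {r_e}) be a hypergraph with f(S) = Σ_{e∈E} w(e)·r_e(|e ∩ S|) and Γ(S) = f(S)/|S|. Let ℓ ∈ {1,…,|V|}, α ∈ (0,1], and set β = α/(α+1). Suppose S_1, …, S_c are pairwise disjoint nonempty subsets of V such that, writing W_i = S_1 ∪ ⋯ ∪ S_{i−1} (so W_1 = ∅) and S = S_1 ∪ ⋯ ∪ S_c: (i) |W_i| < ℓ for every i ∈ {1,…,c}; (ii) |S| ≥ ℓ; and (iii) for every i ∈ {1,…,c} and every nonempty T ⊆ V ∖ W_i, (f(S_i ∪ W_i) − f(W_i))/|S_i| ≥ α·(f(T ∪ W_i) − f(W_i))/|T|. Let S' be any set with W_c ⊆ S' ⊆ V and |S'| = ℓ. Then max(Γ(S), Γ(S')) ≥ β·Γ(O) for every O ⊆ V with |O|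 ≥ ℓ. In other words, this contract-and-repeat procedure yields an α/(α+1)-approximation for the cardinality-constrained densest SWAMP problem with constraint |O| ≥ ℓ. -/
open Finset

/-- A weighted sum of monotone rewards of the intersection sizes with the hyperedges is a
monotone set function. -/
theorem sum_reward_card_inter_mono {α' ι : Type*} [DecidableEq α']
    {E : Finset ι} {edge : ι → Finset α'} {w : ι → ℝ} {r : ι → ℕ → ℝ}
    (hw : ∀ e ∈ E, 0 ≤ w e)
    (hrmono : ∀ e ∈ E, ∀ i, i < (edge e).card → r e i ≤ r e (i + 1))
    {A B : Finset α'} (hAB : A ⊆ B) :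
    ∑ e ∈ E, w e * r e ((edge e ∩ A).card) ≤ ∑ e ∈ E, w e * r e ((edge e ∩ B).card) := by
  refine Finset.sum_le_sum fun e he => mul_le_mul_of_nonneg_left ?_ (hw e he)
  have reward_le : ∀ i j, i ≤ j → j ≤ (edge e).card → r e i ≤ r e j := by
    intro i j hij
    induction j, hij using Nat.le_induction with
    | base => exact fun _ => le_rfl
    | succ j _ ih => exact fun hj => (ih (by lia)).trans (hrmono e he j (by lia))
  exact reward_le _ _ (Finset.card_le_card (Finset.inter_subset_inter_left hAB))
    (Finset.card_le_card Finset.inter_subset_left)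

/-- If contracting `W` leaves `X` as an `a`-approximately densest set, and `W` itself has less than
an `a / (a + 1)` fraction of the value of `O`, then the marginal value of `X` is at least
`a / (a + 1)` times the density of `O`, per element of `X`. -/
theorem marginal_ge_of_approx_densest {α' : Type*} [DecidableEq α']
    {f : Finset α' → ℝ} (hmono : ∀ A B : Finset α', A ⊆ B → f A ≤ f B)
    {V W X O : Finset α'} {a : ℝ} (ha : 0 < a) (hX : X.Nonempty) (hOV : O ⊆ V)
    (hO : 0 ≤ f O)
    (happrox : ∀ T : Finset α', T ⊆ V \ W → T.Nonempty →
      a * ((f (T ∪ W) - f W) / (T.card : ℝ)) ≤ (f (X ∪ W) - f W) / (X.card : ℝ))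
    (hW : f W < a / (a + 1) * f O) :
    a / (a + 1) * (f O / (O.card : ℝ)) * (X.card : ℝ) ≤ f (X ∪ W) - f W := by
  have hβ : a / (a + 1) * f O ≤ f O :=
    mul_le_of_le_one_left hO (by rw [div_le_one (by positivity)]; linarith)
  have hT : (O \ W).Nonempty := by
    rw [Finset.sdiff_nonempty]
    intro h
    linarith [hmono _ _ h]
  have hTpos : (0 : ℝ) < ((O \ W).card : ℝ) := by exact_mod_cast hT.card_pos
  have hcard : ((O \ W).card : ℝ) ≤ (O.card : ℝ) := by
    exact_mod_cast Finset.card_le_card Finset.sdiff_subset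
  have hmarg : f O - a / (a + 1) * f O ≤ f ((O \ W) ∪ W) - f W := by
    have := hmono O ((O \ W) ∪ W) (by simp)
    linarith
  have key := happrox (O \ W) (Finset.sdiff_subset_sdiff hOV le_rfl) hT
  rw [← le_div_iff₀ (by exact_mod_cast hX.card_pos)]
  refine le_trans ?_ key
  calc a / (a + 1) * (f O / (O.card : ℝ))
      = a * ((f O - a / (a + 1) * f O) / (O.card : ℝ)) := by field_simp; ring
    _ ≤ a * ((f ((O \ W) ∪ W) - f W) / ((O \ W).card : ℝ)) := by
        refine mul_le_mul_of_nonneg_left ?_ ha.le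
        exact div_le_div₀ (by linarith) hmarg hTpos hcard

/-- The contract-and-repeat procedure is an `α/(α+1)`-approximation for the
cardinality-constrained densest SWAMP problem.  Here the sets are indexed `0,…,c−1`,
so that `W i = S 0 ∪ ⋯ ∪ S (i−1) = (range i).biUnion S` and the 1-based `W_c` of the
paper is `(range (c−1)).biUnion S`. -/
theorem card_swamp_approximation
    {α' ι : Type*} [DecidableEq α']
    (V : Finset α') (E : Finset ι) (edge : ι → Finset α') (w : ι → ℝ)
    (r : ι → ℕ → ℝ)
    (hedge : ∀ e ∈ E, edge e ⊆ V)
    (hw : ∀ e ∈ E, 0 ≤ w e)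
    (hr0 : ∀ e ∈ E, r e 0 = 0)
    (hrmono : ∀ e ∈ E, ∀ i, i < (edge e).card → r e i ≤ r e (i + 1))
    (f : Finset α' → ℝ)
    (hf : ∀ S : Finset α', f S = ∑ e ∈ E, w e * r e ((edge e ∩ S).card))
    (ℓ : ℕ) (hℓ1 : 1 ≤ ℓ) (hℓV : ℓ ≤ V.card)
    (a : ℝ) (ha0 : 0 < a) (ha1 : a ≤ 1)
    (c : ℕ) (hc : 1 ≤ c)
    (S : ℕ → Finset α')
    (hSV : ∀ i, i < c → S i ⊆ V)
    (hSne : ∀ i, i < c → (S i).Nonempty)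
    (hdisj : ∀ i j, i < c → j < c → i ≠ j → Disjoint (S i) (S j))
    (hWcard : ∀ i, i < c → ((Finset.range i).biUnion S).card < ℓ)
    (hScard : ℓ ≤ ((Finset.range c).biUnion S).card)
    (happrox : ∀ i, i < c → ∀ T : Finset α',
      T ⊆ V \ (Finset.range i).biUnion S → T.Nonempty →
      a * ((f (T ∪ (Finset.range i).biUnion S) - f ((Finset.range i).biUnion S)) /
            (T.card : ℝ)) ≤
        (f (S i ∪ (Finset.range i).biUnion S) - f ((Finset.range i).biUnion S)) /
          ((S i).card : ℝ))
    (S' : Finset α')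
    (hS'W : (Finset.range (c - 1)).biUnion S ⊆ S')
    (hS'V : S' ⊆ V) (hS'card : S'.card = ℓ) :
    ∀ O : Finset α', O ⊆ V → ℓ ≤ O.card →
      (a / (a + 1)) * (f O / (O.card : ℝ)) ≤
        max (f ((Finset.range c).biUnion S) / (((Finset.range c).biUnion S).card : ℝ))
            (f S' / (S'.card : ℝ)) := by
  intro O hOV hOcard
  have hmono : ∀ A B : Finset α', A ⊆ B → f A ≤ f B := fun A B hAB => by
    rw [hf, hf]
    exact sum_reward_card_inter_mono hw hrmono hAB
  have hempty : f ∅ = 0 := by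
    rw [hf]
    exact Finset.sum_eq_zero fun e he => by simp [hr0 e he]
  have hO : 0 ≤ f O := hempty ▸ hmono ∅ O (Finset.empty_subset O)
  have hℓ : (0 : ℝ) < ℓ := by exact_mod_cast hℓ1
  have hℓO : (ℓ : ℝ) ≤ (O.card : ℝ) := by exact_mod_cast hOcard
  rcases le_or_gt (a / (a + 1) * f O) (f ((Finset.range (c - 1)).biUnion S)) with h | h
  · apply le_max_of_le_right
    rw [hS'card, ← mul_div_assoc]
    exact div_le_div₀ (hempty ▸ hmono ∅ S' (Finset.empty_subset S'))
      (h.trans (hmono _ _ hS'W)) hℓ hℓO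
  · apply le_max_of_le_left
    have hd : 0 ≤ a / (a + 1) * (f O / (O.card : ℝ)) := by positivity
    have value_ge : ∀ i, i ≤ c →
        a / (a + 1) * (f O / (O.card : ℝ)) * (((Finset.range i).biUnion S).card : ℝ) ≤
          f ((Finset.range i).biUnion S) := by
      intro i
      induction i with
      | zero => simp [hempty]
      | succ i ih =>
        intro hi
        have hWi : f ((Finset.range i).biUnion S) < a / (a + 1) * f O :=
          (hmono _ _ (Finset.biUnion_subset_biUnion_of_subset_left S
            (Finset.range_subset_range.2 (by lia)))).trans_lt h
        have hstep := marginal_ge_of_approx_densest hmono ha0 (hSne i hi) hOV hO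
          (happrox i hi) hWi
        rw [Finset.range_add_one, Finset.biUnion_insert]
        have hcard : ((S i ∪ (Finset.range i).biUnion S).card : ℝ) ≤
            ((S i).card : ℝ) + (((Finset.range i).biUnion S).card : ℝ) := by
          exact_mod_cast Finset.card_union_le _ _
        linarith [ih (by lia), mul_le_mul_of_nonneg_left hcard hd]
    have hSpos : (0 : ℝ) < (((Finset.range c).biUnion S).card : ℝ) := by
      exact_mod_cast hℓ1.trans hScard
    exact (le_div_iff₀ hSpos).2 (value_ge c le_rfl)
end

section
/- Let H = (V, E, w, {r_e}) be a hypergraph with f(S) = Σ_{e∈E} w(e)·r_e(|e ∩ S|) and Γ(S) = f(S)/|S|. Let α ∈ (0,1] and β = α/(α+1). Suppose S_1, …, S_c are pairwise disjoint nonempty subsets of V, write W_i = S_1 ∪ ⋯ ∪ S_{i−1} and S = S_1 ∪ ⋯ ∪ S_c, and suppose that for every i ∈ {1,…,c} and every nonempty T ⊆ V ∖ W_i, (f(S_i ∪ W_i) − f(W_i))/|S_i| ≥ α·(f(T ∪ W_i) − f(W_i))/|T|. Let O ⊆ V be a set with O ∖ W_i ≠ ∅ for every i ∈ {1,…,c}.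 If f(W_c) ≤ β·f(O), then Γ(S) ≥ β·Γ(O). -/
open Finset

/-- A step-monotone function on `{0,…,m}` is monotone there. -/
theorem le_of_forall_lt_le_succ {r : ℕ → ℝ} {m : ℕ} (h : ∀ i, i < m → r i ≤ r (i + 1))
    {x y : ℕ} (hxy : x ≤ y) (hy : y ≤ m) : r x ≤ r y := by
  induction y, hxy using Nat.le_induction with
  | base => exact le_rfl
  | succ n _ ih => exact (ih (by omega)).trans (h n (by omega))

/-- The total reward of a hypergraph with monotone reward functions is monotone. -/
theorem sum_mul_reward_mono {α ι : Type*} [DecidableEq α] {E : Finset ι}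
    {edge : ι → Finset α} {w : ι → ℝ} {r : ι → ℕ → ℝ} (hw : ∀ e ∈ E, 0 ≤ w e)
    (hr : ∀ e ∈ E, ∀ i, i < (edge e).card → r e i ≤ r e (i + 1))
    {A B : Finset α} (hAB : A ⊆ B) :
    ∑ e ∈ E, w e * r e ((edge e ∩ A).card) ≤ ∑ e ∈ E, w e * r e ((edge e ∩ B).card) :=
  Finset.sum_le_sum fun e he => mul_le_mul_of_nonneg_left
    (le_of_forall_lt_le_succ (hr e he)
      (Finset.card_le_card (Finset.inter_subset_inter_left hAB))
      (Finset.card_le_card Finset.inter_subset_left)) (hw e he)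

/-- First case of the analysis of the contract-and-repeat procedure: if the total reward
of the removed set `W_c` is at most `β·f(O)` with `β = α/(α+1)`, then the union
`S = S_1 ∪ ⋯ ∪ S_c` satisfies `Γ(S) ≥ β·Γ(O)`.  Sets are indexed `0,…,c−1`, so
`W i = (range i).biUnion S` and the 1-based `W_c` of the paper is
`(range (c−1)).biUnion S`. -/
theorem card_swamp_case_small_removed
    {α' ι : Type*} [DecidableEq α']
    (V : Finset α') (E : Finset ι) (edge : ι → Finset α') (w : ι → ℝ)
    (r : ι → ℕ → ℝ)
    (hedge : ∀ e ∈ E, edge e ⊆ V)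
    (hw : ∀ e ∈ E, 0 ≤ w e)
    (hr0 : ∀ e ∈ E, r e 0 = 0)
    (hrmono : ∀ e ∈ E, ∀ i, i < (edge e).card → r e i ≤ r e (i + 1))
    (f : Finset α' → ℝ)
    (hf : ∀ S : Finset α', f S = ∑ e ∈ E, w e * r e ((edge e ∩ S).card))
    (a : ℝ) (ha0 : 0 < a) (ha1 : a ≤ 1)
    (c : ℕ) (hc : 1 ≤ c)
    (S : ℕ → Finset α')
    (hSV : ∀ i, i < c → S i ⊆ V)
    (hSne : ∀ i, i < c → (S i).Nonempty)
    (hdisj : ∀ i j, i < c → j < c → i ≠ j → Disjoint (S i) (S j))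
    (happrox : ∀ i, i < c → ∀ T : Finset α',
      T ⊆ V \ (Finset.range i).biUnion S → T.Nonempty →
      a * ((f (T ∪ (Finset.range i).biUnion S) - f ((Finset.range i).biUnion S)) /
            (T.card : ℝ)) ≤
        (f (S i ∪ (Finset.range i).biUnion S) - f ((Finset.range i).biUnion S)) /
          ((S i).card : ℝ))
    (O : Finset α') (hOV : O ⊆ V)
    (hOW : ∀ i, i < c → (O \ (Finset.range i).biUnion S).Nonempty)
    (hfW : f ((Finset.range (c - 1)).biUnion S) ≤ (a / (a + 1)) * f O) :
    (a / (a + 1)) * (f O / (O.card : ℝ)) ≤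
      f ((Finset.range c).biUnion S) / (((Finset.range c).biUnion S).card : ℝ) := by
  have hmono : ∀ A B : Finset α', A ⊆ B → f A ≤ f B := fun A B hAB => by
    rw [hf, hf]
    exact sum_mul_reward_mono hw hrmono hAB
  have hempty : f ∅ = 0 := by
    rw [hf]
    exact Finset.sum_eq_zero fun e he => by simp [hr0 e he]
  have hO0 : 0 ≤ f O := hempty ▸ hmono ∅ O (Finset.empty_subset O)
  set b : ℝ := a / (a + 1) * (f O / (O.card : ℝ)) with hb
  have hb0 : 0 ≤ b := by positivity
  have hgain : ∀ i, i < c → b * ((S i).card : ℝ) ≤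
      f (S i ∪ (Finset.range i).biUnion S) - f ((Finset.range i).biUnion S) := by
    intro i hi
    set W := (Finset.range i).biUnion S with hW
    have hS : (0 : ℝ) < (S i).card := by exact_mod_cast (hSne i hi).card_pos
    have hT : (0 : ℝ) < (O \ W).card := by exact_mod_cast (hOW i hi).card_pos
    have hTO : ((O \ W).card : ℝ) ≤ O.card := by
      exact_mod_cast Finset.card_le_card Finset.sdiff_subset
    have hWc : f W ≤ a / (a + 1) * f O :=
      (hmono _ _ (Finset.biUnion_subset_biUnion_of_subset_left S
        (Finset.range_subset_range.2 (by omega)))).trans hfW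
    have hOT : f O ≤ f ((O \ W) ∪ W) := hmono _ _ (by
      rw [Finset.sdiff_union_self_eq_union]
      exact Finset.subset_union_left)
    have hrest : f O / (a + 1) ≤ f ((O \ W) ∪ W) - f W := by
      have : f O / (a + 1) = f O - a / (a + 1) * f O := by field_simp; ring
      linarith
    rw [← le_div_iff₀ hS]
    refine le_trans ?_ (happrox i hi (O \ W) (Finset.sdiff_subset_sdiff hOV le_rfl) (hOW i hi))
    calc b = a * (f O / (a + 1) / (O.card : ℝ)) := by rw [hb]; ring
      _ ≤ a * ((f ((O \ W) ∪ W) - f W) / ((O \ W).card : ℝ)) := by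
        have : 0 ≤ f O / (a + 1) := by positivity
        gcongr
        exact this.trans hrest
  have hsum : ∀ n, n ≤ c → b * (((Finset.range n).biUnion S).card : ℝ) ≤
      f ((Finset.range n).biUnion S) := by
    intro n
    induction n with
    | zero => simp [hempty]
    | succ n ih =>
      intro hn
      rw [Finset.range_add_one, Finset.biUnion_insert]
      have hcard : ((S n ∪ (Finset.range n).biUnion S).card : ℝ) ≤
          (S n).card + ((Finset.range n).biUnion S).card := by
        exact_mod_cast Finset.card_union_le _ _
      have := mul_le_mul_of_nonneg_left hcard hb0
      linarith [ih (by omega), hgain n (by omega)]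
  have hpos : (0 : ℝ) < ((Finset.range c).biUnion S).card := by
    obtain ⟨x, hx⟩ := hSne 0 hc
    exact_mod_cast Finset.card_pos.2 ⟨x, Finset.mem_biUnion.2 ⟨0, Finset.mem_range.2 hc, hx⟩⟩
  exact (le_div_iff₀ hpos).2 (hsum c le_rfl)
end

section
/- Let H = (V, E, w, {r_e}) be a hypergraph with f(S) = Σ_{e∈E} w(e)·r_e(|e ∩ S|) and Γ(S) = f(S)/|S|. Let C_1, …, C_m partition V, let ℓ_1, …, ℓ_m be nonnegative integers with ℓ_i ≤ |C_i|, and set ℓ = Σ_i ℓ_i. Let α ∈ (0,1] and let S ⊆ V be nonempty with |S| ≥ ℓ and Γ(S) ≥ α·Γ(T) for every T ⊆ V with |T| ≥ ℓ (an α-approximation for CARD-SWAMP with parameter ℓ). Let S' be obtained from S by adding, for each i, exactly max(0, ℓ_i − |S ∩ C_i|) nodes of C_i ∖ S (so |S'| = |S| + Σ_i max(0, ℓ_i − |S ∩ C_i|) and |S' ∩ C_i| ≥ ℓ_i for all i). Then Γ(S') ≥ (α/2)·Γ(T) for every T ⊆ V satisfying |T ∩ C_i| ≥ ℓ_i for all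 i; that is, S' is an (α/2)-approximation for FAIR-SWAMP. -/
open Finset

/-- A sequence that increases at each step below `n` is monotone on `{0, …, n}`. -/
theorem le_of_step_le_of_le_bound {g : ℕ → ℝ} {n : ℕ}
    (hg : ∀ i, i < n → g i ≤ g (i + 1)) {i j : ℕ} (hij : i ≤ j) (hj : j ≤ n) :
    g i ≤ g j := by
  induction j, hij using Nat.le_induction with
  | base => exact le_rfl
  | succ k _ ih => exact (ih (by omega)).trans (hg k (by omega))

/-- The weighted reward `∑ e, w e * r e |e ∩ S|` is monotone in `S`. -/
theorem sum_reward_mono {α' ι : Type*} [DecidableEq α']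
    {E : Finset ι} {edge : ι → Finset α'} {w : ι → ℝ} {r : ι → ℕ → ℝ}
    (hw : ∀ e ∈ E, 0 ≤ w e)
    (hrmono : ∀ e ∈ E, ∀ i, i < (edge e).card → r e i ≤ r e (i + 1))
    {S T : Finset α'} (hST : S ⊆ T) :
    ∑ e ∈ E, w e * r e ((edge e ∩ S).card) ≤ ∑ e ∈ E, w e * r e ((edge e ∩ T).card) :=
  Finset.sum_le_sum fun e he => mul_le_mul_of_nonneg_left
    (le_of_step_le_of_le_bound (hrmono e he)
      (Finset.card_le_card (Finset.inter_subset_inter_left hST))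
      (Finset.card_le_card Finset.inter_subset_left)) (hw e he)

/-- Padding an `α`-approximate CARD-SWAMP solution (with parameter `ℓ = Σ_i ℓ_i`)
by adding, for each class `C_i`, exactly `max(0, ℓ_i − |S ∩ C_i|)` nodes of `C_i ∖ S`,
yields an `α/2`-approximate solution for FAIR-SWAMP. -/
theorem fair_swamp_approximation
    {α' ι : Type*} [DecidableEq α']
    (V : Finset α') (E : Finset ι) (edge : ι → Finset α') (w : ι → ℝ)
    (r : ι → ℕ → ℝ)
    (hedge : ∀ e ∈ E, edge e ⊆ V)
    (hw : ∀ e ∈ E, 0 ≤ w e)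
    (hr0 : ∀ e ∈ E, r e 0 = 0)
    (hrmono : ∀ e ∈ E, ∀ i, i < (edge e).card → r e i ≤ r e (i + 1))
    (f : Finset α' → ℝ)
    (hf : ∀ S : Finset α', f S = ∑ e ∈ E, w e * r e ((edge e ∩ S).card))
    (m : ℕ) (C : ℕ → Finset α')
    (hCV : (Finset.range m).biUnion C = V)
    (hCdisj : ∀ i j, i < m → j < m → i ≠ j → Disjoint (C i) (C j))
    (ℓ : ℕ → ℕ) (hℓC : ∀ i, i < m → ℓ i ≤ (C i).card)
    (a : ℝ) (ha0 : 0 < a) (ha1 : a ≤ 1)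
    (S : Finset α') (hSV : S ⊆ V) (hSne : S.Nonempty)
    (hScard : ∑ i ∈ Finset.range m, ℓ i ≤ S.card)
    (happrox : ∀ T : Finset α', T ⊆ V → ∑ i ∈ Finset.range m, ℓ i ≤ T.card →
      a * (f T / (T.card : ℝ)) ≤ f S / (S.card : ℝ))
    (A : ℕ → Finset α')
    (hA : ∀ i, i < m → A i ⊆ C i \ S ∧ (A i).card = ℓ i - (S ∩ C i).card)
    (S' : Finset α') (hS' : S' = S ∪ (Finset.range m).biUnion A) :
    ∀ T : Finset α', T ⊆ V → (∀ i, i < m → ℓ i ≤ (T ∩ C i).card) →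
      (a / 2) * (f T / (T.card : ℝ)) ≤ f S' / (S'.card : ℝ) := by
  intro T hTV hT
  have hTcard : ∑ i ∈ Finset.range m, ℓ i ≤ T.card := by
    calc ∑ i ∈ Finset.range m, ℓ i ≤ ∑ i ∈ Finset.range m, (T ∩ C i).card :=
          Finset.sum_le_sum fun i hi => hT i (Finset.mem_range.mp hi)
      _ = ((Finset.range m).biUnion fun i => T ∩ C i).card := by
          refine (Finset.card_biUnion fun i hi j hj hij => ?_).symm
          exact (hCdisj i j (Finset.mem_range.mp hi) (Finset.mem_range.mp hj) hij).mono
            Finset.inter_subset_right Finset.inter_subset_right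
      _ ≤ T.card := Finset.card_le_card
          (Finset.biUnion_subset.mpr fun _ _ => Finset.inter_subset_left)
  have hSS' : S ⊆ S' := hS' ▸ Finset.subset_union_left
  have hS'card : S'.card ≤ 2 * S.card := by
    have hA' : ((Finset.range m).biUnion A).card ≤ ∑ i ∈ Finset.range m, ℓ i :=
      Finset.card_biUnion_le.trans <| Finset.sum_le_sum fun i hi => by
        rw [(hA i (Finset.mem_range.mp hi)).2]
        exact Nat.sub_le _ _
    have hunion := Finset.card_union_le S ((Finset.range m).biUnion A)
    rw [hS']
    omega
  have hfmono : f S ≤ f S' := by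
    rw [hf, hf]
    exact sum_reward_mono hw hrmono hSS'
  have hfS : 0 ≤ f S := by
    have h := sum_reward_mono hw hrmono (Finset.empty_subset S)
    rw [← hf S] at h
    refine le_trans (le_of_eq (Finset.sum_eq_zero fun e he => ?_).symm) h
    simp [hr0 e he]
  have hSpos : (0 : ℝ) < S.card := by exact_mod_cast hSne.card_pos
  have hS'pos : (0 : ℝ) < S'.card := by exact_mod_cast (hSne.mono hSS').card_pos
  have hS'le : (S'.card : ℝ) ≤ 2 * S.card := by exact_mod_cast hS'card
  calc a / 2 * (f T / (T.card : ℝ)) = a * (f T / (T.card : ℝ)) / 2 := by ring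
    _ ≤ f S / (S.card : ℝ) / 2 := by linarith [happrox T hTV hTcard]
    _ = f S / (2 * S.card) := by rw [div_div, mul_comm]
    _ ≤ f S' / (S'.card : ℝ) := div_le_div₀ (hfS.trans hfmono) hfmono hS'pos hS'le
end

section
/- Correctness of the ILP formulation: let H = (V, E, w, {r_e}) be a hypergraph and define δ_{e,i} = r_e(i) − r_e(i−1) ≥ 0 for each e ∈ E and i ∈ {1,…,|e|}. Fix S ⊆ V and set x_v = 1 if v ∈ S and x_v = 0 otherwise. Then the maximum of Σ_{e∈E} w(e) Σ_{i=1}^{|e|} δ_{e,i}·y_{e,i} over all choices of y_{e,i} ∈ {0,1} satisfying y_{e,i} ≤ (1/i)·Σ_{v∈e} x_v equals f(S) = Σ_{e∈E} w(e)·r_e(|e ∩ S|); the maximum is attained by setting y_{e,i} = 1 exactly when |e ∩ S| ≥ i. Consequently, for any α ∈ ℝ, the optimal value of the integer linear program maximizing Σ_{e∈E} w(e) Σ_{i=1}^{|e|} δ_{e,i}·y_{e,i} − α·Σ_{v∈V} x_v over x ∈ {0,1}^V and feasible y equals max_{S ⊆ V} ( f(S) − α·|S| ). -/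
open Finset

theorem sum_sub_pred_mul_indicator (r : ℕ → ℝ) {k n : ℕ} (hkn : k ≤ n) :
    ∑ i ∈ Finset.Icc 1 n, (r i - r (i - 1)) * (if i ≤ k then (1 : ℝ) else 0) = r k - r 0 := by
  have hfilter : (Finset.Icc 1 n).filter (fun i => i ≤ k) = Finset.Ico 1 (k + 1) := by
    ext i
    simp only [Finset.mem_filter, Finset.mem_Icc, Finset.mem_Ico]
    omega
  simp only [mul_ite, mul_one, mul_zero]
  rw [← Finset.sum_filter, hfilter, Finset.sum_Ico_eq_sum_range]
  simp only [Nat.add_sub_cancel, add_comm 1]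
  exact Finset.sum_range_sub r k

theorem indicator_le_div (k : ℕ) {i : ℕ} (hi : 1 ≤ i) :
    (if i ≤ k then (1 : ℝ) else 0) ≤ (k : ℝ) / (i : ℝ) := by
  have hpos : (0 : ℝ) < i := by exact_mod_cast hi
  split_ifs with h
  · rw [le_div_iff₀ hpos, one_mul]
    exact_mod_cast h
  · positivity

theorem le_indicator_of_le_div {k i : ℕ} {y : ℝ} (hi : 1 ≤ i) (hy : y = 0 ∨ y = 1)
    (hle : y ≤ (k : ℝ) / (i : ℝ)) : y ≤ if i ≤ k then (1 : ℝ) else 0 := by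
  have hpos : (0 : ℝ) < i := by exact_mod_cast hi
  rcases hy with rfl | rfl
  · split_ifs <;> norm_num
  · rw [le_div_iff₀ hpos, one_mul] at hle
    rw [if_pos (by exact_mod_cast hle)]

theorem sum_sub_pred_mul_le {r y : ℕ → ℝ} {k n : ℕ} (hkn : k ≤ n) (hr0 : r 0 = 0)
    (hr : ∀ i, i < n → r i ≤ r (i + 1))
    (hy : ∀ i, 1 ≤ i → i ≤ n → (y i = 0 ∨ y i = 1) ∧ y i ≤ (k : ℝ) / (i : ℝ)) :
    ∑ i ∈ Finset.Icc 1 n, (r i - r (i - 1)) * y i ≤ r k := by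
  calc
    _ ≤ ∑ i ∈ Finset.Icc 1 n, (r i - r (i - 1)) * (if i ≤ k then (1 : ℝ) else 0) := by
      refine Finset.sum_le_sum fun i hi => ?_
      obtain ⟨h1, hn⟩ := Finset.mem_Icc.mp hi
      have hstep := hr (i - 1) (by omega)
      rw [Nat.sub_add_cancel h1] at hstep
      exact mul_le_mul_of_nonneg_left
        (le_indicator_of_le_div h1 (hy i h1 hn).1 (hy i h1 hn).2) (sub_nonneg.mpr hstep)
    _ = r k := by rw [sum_sub_pred_mul_indicator r hkn, hr0, sub_zero]

/-- Correctness of the ILP formulation for the densest SWAMP problem.  With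
`δ_{e,i} = r_e(i) − r_e(i−1)`, for a fixed `S ⊆ V` the maximum of
`Σ_e w(e) Σ_{i=1}^{|e|} δ_{e,i} y_{e,i}` over `y_{e,i} ∈ {0,1}` with
`y_{e,i} ≤ |e ∩ S| / i` equals `f(S)`, attained by `y_{e,i} = 1` iff `|e ∩ S| ≥ i`;
consequently, for every `α`, the ILP objective `Σ_e w(e) Σ_i δ_{e,i} y_{e,i} − α Σ_v x_v`
has the same optimal value as `max_{S ⊆ V} (f(S) − α·|S|)`. -/
theorem swamp_ilp_correct
    {α' ι : Type*} [DecidableEq α']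
    (V : Finset α') (E : Finset ι) (edge : ι → Finset α') (w : ι → ℝ)
    (r : ι → ℕ → ℝ)
    (hedge : ∀ e ∈ E, edge e ⊆ V)
    (hw : ∀ e ∈ E, 0 ≤ w e)
    (hr0 : ∀ e ∈ E, r e 0 = 0)
    (hrmono : ∀ e ∈ E, ∀ i, i < (edge e).card → r e i ≤ r e (i + 1)) :
    (∀ S : Finset α', S ⊆ V →
      IsGreatest
        {z : ℝ | ∃ y : ι → ℕ → ℝ,
          (∀ e ∈ E, ∀ i, 1 ≤ i → i ≤ (edge e).card →
            (y e i = 0 ∨ y e i = 1) ∧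
            y e i ≤ ((edge e ∩ S).card : ℝ) / (i : ℝ)) ∧
          z = ∑ e ∈ E, w e * ∑ i ∈ Finset.Icc 1 (edge e).card,
                (r e i - r e (i - 1)) * y e i}
        (∑ e ∈ E, w e * r e ((edge e ∩ S).card)) ∧
      (∀ e ∈ E, ∀ i, 1 ≤ i → i ≤ (edge e).card →
        ((if i ≤ (edge e ∩ S).card then (1 : ℝ) else 0) = 0 ∨
          (if i ≤ (edge e ∩ S).card then (1 : ℝ) else 0) = 1) ∧
        (if i ≤ (edge e ∩ S).card then (1 : ℝ) else 0) ≤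
          ((edge e ∩ S).card : ℝ) / (i : ℝ)) ∧
      (∑ e ∈ E, w e * ∑ i ∈ Finset.Icc 1 (edge e).card,
          (r e i - r e (i - 1)) * (if i ≤ (edge e ∩ S).card then (1 : ℝ) else 0)) =
        ∑ e ∈ E, w e * r e ((edge e ∩ S).card))
    ∧
    (∀ αr M : ℝ,
      IsGreatest
        {z : ℝ | ∃ S : Finset α', S ⊆ V ∧ ∃ y : ι → ℕ → ℝ,
          (∀ e ∈ E, ∀ i, 1 ≤ i → i ≤ (edge e).card →
            (y e i = 0 ∨ y e i = 1) ∧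
            y e i ≤ ((edge e ∩ S).card : ℝ) / (i : ℝ)) ∧
          z = (∑ e ∈ E, w e * ∑ i ∈ Finset.Icc 1 (edge e).card,
                (r e i - r e (i - 1)) * y e i) - αr * (S.card : ℝ)} M
      ↔
      IsGreatest
        {z : ℝ | ∃ S : Finset α', S ⊆ V ∧
          z = (∑ e ∈ E, w e * r e ((edge e ∩ S).card)) - αr * (S.card : ℝ)} M) := by
  have hcard (S : Finset α') (e : ι) : (edge e ∩ S).card ≤ (edge e).card :=
    Finset.card_le_card Finset.inter_subset_left
  have hfeas (S : Finset α') : ∀ e ∈ E, ∀ i, 1 ≤ i → i ≤ (edge e).card →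
      ((if i ≤ (edge e ∩ S).card then (1 : ℝ) else 0) = 0 ∨
        (if i ≤ (edge e ∩ S).card then (1 : ℝ) else 0) = 1) ∧
      (if i ≤ (edge e ∩ S).card then (1 : ℝ) else 0) ≤ ((edge e ∩ S).card : ℝ) / (i : ℝ) :=
    fun e _ i hi _ => ⟨(ite_eq_or_eq _ _ _).symm, indicator_le_div _ hi⟩
  have hval (S : Finset α') :
      (∑ e ∈ E, w e * ∑ i ∈ Finset.Icc 1 (edge e).card,
        (r e i - r e (i - 1)) * (if i ≤ (edge e ∩ S).card then (1 : ℝ) else 0)) =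
      ∑ e ∈ E, w e * r e ((edge e ∩ S).card) :=
    Finset.sum_congr rfl fun e he => by
      rw [sum_sub_pred_mul_indicator (r e) (hcard S e), hr0 e he, sub_zero]
  have hbound (S : Finset α') (y : ι → ℕ → ℝ)
      (hy : ∀ e ∈ E, ∀ i, 1 ≤ i → i ≤ (edge e).card →
        (y e i = 0 ∨ y e i = 1) ∧ y e i ≤ ((edge e ∩ S).card : ℝ) / (i : ℝ)) :
      (∑ e ∈ E, w e * ∑ i ∈ Finset.Icc 1 (edge e).card, (r e i - r e (i - 1)) * y e i) ≤
        ∑ e ∈ E, w e * r e ((edge e ∩ S).card) :=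
    Finset.sum_le_sum fun e he => mul_le_mul_of_nonneg_left
      (sum_sub_pred_mul_le (hcard S e) (hr0 e he) (hrmono e he) (hy e he)) (hw e he)
  refine ⟨fun S _ => ⟨⟨⟨_, hfeas S, (hval S).symm⟩, ?_⟩, hfeas S, hval S⟩, fun αr M => ?_⟩
  · rintro z ⟨y, hy, rfl⟩
    exact hbound S y hy
  constructor
  · rintro ⟨⟨S, hS, y, hy, rfl⟩, hmax⟩
    have hopt : ∀ T ⊆ V, (∑ e ∈ E, w e * r e ((edge e ∩ T).card)) - αr * (T.card : ℝ) ≤ _ :=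
      fun T hT => hmax ⟨T, hT, _, hfeas T, by rw [hval T]⟩
    refine ⟨⟨S, hS, le_antisymm (sub_le_sub_right (hbound S y hy) _) (hopt S hS)⟩, ?_⟩
    rintro z ⟨T, hT, rfl⟩
    exact hopt T hT
  · rintro ⟨⟨S, hS, rfl⟩, hmax⟩
    refine ⟨⟨S, hS, _, hfeas S, by rw [hval S]⟩, ?_⟩
    rintro z ⟨T, hT, y, hy, rfl⟩
    exact (sub_le_sub_right (hbound T y hy) _).trans (hmax ⟨T, hT, rfl⟩)
end
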